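/- There is a constant C > 0 depending only on c and d such that the following holds. Consider the (1+1) EA on the uniform-profit instance of the chance-constrained knapsack problem with correlated uniform weights, with n ≥ 2, for any K, m ≥ 1 (n = K·m), any a > 0, B > 0 and 0 < α < 1. For every initial solution x₀ ∈ {0,1}^n, the expected number of iterations until the current solution is, for the first time, a feasible solution of maximal profit among all feasible solutions is at most C·n³·(1 + log n). -/

import Mathlib

open Finset
open scoped ENNReal

noncomputable section

/-- Number of one-bits (selected items) of a solution. -/
def numOnes (K m : ℕ) (x : Fin K → Fin m → Bool) : ℕ :=
  ∑ i, ∑ j, if x i j then 1 else 0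

/-- Covariance contribution `2c·Σᵢ Σ_{j1<j2} x_{ij1}·x_{ij2}` of a solution. -/
def cova (K m : ℕ) (c : ℝ) (x : Fin K → Fin m → Bool) : ℝ :=
  2 * c * ∑ i, ∑ p ∈ Finset.univ.filter (fun p : Fin m × Fin m => p.1 < p.2),
      (if x i p.1 then (1 : ℝ) else 0) * (if x i p.2 then (1 : ℝ) else 0)

/-- Expected weight `E[W(x)] = a·|x|₁`. -/
def expWeight (K m : ℕ) (a : ℝ) (x : Fin K → Fin m → Bool) : ℝ :=
  a * (numOnes K m x : ℝ)

/-- Variance `Var[W(x)] = d·|x|₁ + 2c·Σᵢ Σ_{j1<j2} x_{ij1}·x_{ij2}`. -/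
def varWeight (K m : ℕ) (d c : ℝ) (x : Fin K → Fin m → Bool) : ℝ :=
  d * (numOnes K m x : ℝ) + cova K m c x

/-- Chebyshev surrogate `β(x) = Var[W(x)] / (Var[W(x)] + (B − E[W(x)])²)`. -/
def chebBeta (K m : ℕ) (a d c B : ℝ) (x : Fin K → Fin m → Bool) : ℝ :=
  varWeight K m d c x / (varWeight K m d c x + (B - expWeight K m a x) ^ 2)

/-- A solution is feasible if `E[W(x)] < B` and `β(x) ≤ α`. -/
def feasible (K m : ℕ) (a d c B α : ℝ) (x : Fin K → Fin m → Bool) : Prop :=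
  expWeight K m a x < B ∧ chebBeta K m a d c B x ≤ α

/-- `β'(x) = β(x)` if `E[W(x)] < B`, and `β'(x) = 1 + E[W(x)] − B` otherwise. -/
def betaPrime (K m : ℕ) (a d c B : ℝ) (x : Fin K → Fin m → Bool) : ℝ :=
  if expWeight K m a x < B then chebBeta K m a d c B x else 1 + expWeight K m a x - B

/-- Total profit `p(x) = Σᵢⱼ p_{ij}·x_{ij}`. -/
def profitOf (K m : ℕ) (profit : Fin K → Fin m → ℝ) (x : Fin K → Fin m → Bool) : ℝ :=
  ∑ i, ∑ j, if x i j then profit i j else 0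

/-- `p'(x) = −1` if `β'(x) > α`, and `p'(x) = p(x)` otherwise. -/
def pPrime (K m : ℕ) (a d c B α : ℝ) (profit : Fin K → Fin m → ℝ)
    (x : Fin K → Fin m → Bool) : ℝ :=
  if α < betaPrime K m a d c B x then -1 else profitOf K m profit x

/-- Lexicographic fitness dominance: `f(y) ⪰ f(x)` iff `p'(y) > p'(x)`, or
`p'(y) = p'(x)` and `β'(y) ≤ β'(x)`. -/
def fge (K m : ℕ) (a d c B α : ℝ) (profit : Fin K → Fin m → ℝ)
    (y x : Fin K → Fin m → Bool) : Prop :=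
  pPrime K m a d c B α profit x < pPrime K m a d c B α profit y ∨
    (pPrime K m a d c B α profit y = pPrime K m a d c B α profit x ∧
      betaPrime K m a d c B y ≤ betaPrime K m a d c B x)

/-- Hamming distance between two solutions. -/
def hdist (K m : ℕ) (x y : Fin K → Fin m → Bool) : ℕ :=
  ∑ i, ∑ j, if x i j = y i j then 0 else 1

/-- Standard-bit mutation of the (1+1) EA: each bit flips independently with
probability `1/n`, so `y` is produced from `x` with probability
`(1/n)^{H(x,y)}·(1 − 1/n)^{n − H(x,y)}`. -/
def mutEA (K m : ℕ) (x y : Fin K → Fin m → Bool) : ℝ≥0∞ :=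
  (1 / (K * m : ℝ≥0∞)) ^ hdist K m x y *
    (1 - 1 / (K * m : ℝ≥0∞)) ^ (K * m - hdist K m x y)

/-- RLS mutation: with probability `1/2` flip one uniformly random bit, with probability
`1/2` flip a uniformly random pair of distinct bits; so a one-bit-flip neighbour is
produced with probability `1/(2n)` and a two-bit-flip neighbour with probability
`1/(n(n−1))`. -/
def mutRLS (K m : ℕ) (x y : Fin K → Fin m → Bool) : ℝ≥0∞ :=
  if hdist K m x y = 1 then 1 / (2 * (K * m : ℝ≥0∞))
  else if hdist K m x y = 2 then 1 / ((K * m : ℝ≥0∞) * ((K * m : ℝ≥0∞) - 1))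
  else 0

open scoped Classical in
/-- One-step transition probability of an elitist algorithm with mutation distribution
`mutD` and acceptance relation `acc y x` (= "`f(y) ⪰ f(x)`"): the offspring is accepted
iff `acc`, otherwise the algorithm stays at `x`. -/
def stepP (K m : ℕ)
    (mutD : (Fin K → Fin m → Bool) → (Fin K → Fin m → Bool) → ℝ≥0∞)
    (acc : (Fin K → Fin m → Bool) → (Fin K → Fin m → Bool) → Prop)
    (x y : Fin K → Fin m → Bool) : ℝ≥0∞ :=
  (if acc y x then mutD x y else 0) +
    (if y = x then ∑ z, (if acc z x then 0 else mutD x z) else 0)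

open scoped Classical in
/-- `hitVec K m P A x₀ t y` is the probability that the Markov chain with transition
matrix `P` started at `x₀` has not visited the target set `A` during the first `t` steps
and is currently at `y`. -/
def hitVec (K m : ℕ)
    (P : (Fin K → Fin m → Bool) → (Fin K → Fin m → Bool) → ℝ≥0∞)
    (A : (Fin K → Fin m → Bool) → Prop) (x₀ : Fin K → Fin m → Bool) :
    ℕ → (Fin K → Fin m → Bool) → ℝ≥0∞
  | 0 => fun y => if y = x₀ ∧ ¬ A y then 1 else 0
  | (t + 1) => fun y => if A y then 0 else ∑ x, hitVec K m P A x₀ t x * P x y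

/-- Expected hitting time `E[min {t : X_t ∈ A}]` of the target set `A` for the Markov
chain with transition matrix `P` started at `x₀`, computed as `Σ_{t≥0} Pr(T > t)`. -/
def expHitTime (K m : ℕ)
    (P : (Fin K → Fin m → Bool) → (Fin K → Fin m → Bool) → ℝ≥0∞)
    (A : (Fin K → Fin m → Bool) → Prop) (x₀ : Fin K → Fin m → Bool) : ℝ≥0∞ :=
  ∑' t : ℕ, ∑ y, hitVec K m P A x₀ t y

/-- Covariance `s_ℓ^b` of a balanced solution with `ℓ` one-bits: with `q = ⌊ℓ/K⌋` and
`t = ℓ − qK`, it is `c·[(K − t)·q(q − 1) + t·(q + 1)q]`. -/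
def balCov (K : ℕ) (c : ℝ) (ℓ : ℕ) : ℝ :=
  c * (((K - (ℓ - (ℓ / K) * K)) * ((ℓ / K) * (ℓ / K - 1)) +
        (ℓ - (ℓ / K) * K) * ((ℓ / K + 1) * (ℓ / K)) : ℕ) : ℝ)

/-- The solution obtained from `y` by setting bit `(i, j)` to one. -/
def flipUp (K m : ℕ) (y : Fin K → Fin m → Bool) (i : Fin K) (j : Fin m) :
    Fin K → Fin m → Bool :=
  fun i' j' => if i' = i ∧ j' = j then true else y i' j'

end

abbrev Sol (K m : ℕ) := Fin K → Fin m → Bool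

theorem expHit_le (K m : ℕ) (P : Sol K m → Sol K m → ℝ≥0∞) (A : Sol K m → Prop)
    (Φ : Sol K m → ℝ≥0∞) (h : ∀ x, ¬ A x → 1 + ∑ y, P x y * Φ y ≤ Φ x) (x₀ : Sol K m) :
    expHitTime K m P A x₀ ≤ Φ x₀ := by
  classical
  have hA : ∀ t x, A x → hitVec K m P A x₀ t x = 0 := by
    intro t x hx
    cases t <;> simp [hitVec, hx]
  have step : ∀ t, (∑ y, hitVec K m P A x₀ t y) + ∑ y, hitVec K m P A x₀ (t+1) y * Φ y
      ≤ ∑ y, hitVec K m P A x₀ t y * Φ y := by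
    intro t
    have h1 : ∑ y, hitVec K m P A x₀ (t+1) y * Φ y
        ≤ ∑ y, (∑ x, hitVec K m P A x₀ t x * P x y) * Φ y := by
      refine Finset.sum_le_sum fun y _ => ?_
      gcongr
      simp only [hitVec]
      split_ifs <;> simp
    have h2 : ∑ y, (∑ x, hitVec K m P A x₀ t x * P x y) * Φ y
        = ∑ x, hitVec K m P A x₀ t x * ∑ y, P x y * Φ y := by
      simp only [Finset.sum_mul, Finset.mul_sum]
      rw [Finset.sum_comm]
      simp only [mul_assoc]
    calc _ ≤ (∑ y, hitVec K m P A x₀ t y) + ∑ x, hitVec K m P A x₀ t x * ∑ y, P x y * Φ y := by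
            rw [← h2]; gcongr
      _ = ∑ x, hitVec K m P A x₀ t x * (1 + ∑ y, P x y * Φ y) := by
            rw [← Finset.sum_add_distrib]
            simp only [mul_add, mul_one]
      _ ≤ _ := by
            refine Finset.sum_le_sum fun x _ => ?_
            by_cases hx : A x
            · simp [hA t x hx]
            · gcongr
              exact h x hx
  have key : ∀ T, (∑ t ∈ Finset.range T, ∑ y, hitVec K m P A x₀ t y)
      + ∑ y, hitVec K m P A x₀ T y * Φ y ≤ Φ x₀ := by
    intro T
    induction T with
    | zero =>
      simp only [Finset.range_zero, Finset.sum_empty, zero_add]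
      rw [Finset.sum_eq_single x₀]
      · simp only [hitVec]; split_ifs <;> simp
      · intro b _ hb; simp [hitVec, hb]
      · simp
    | succ T ih =>
      rw [Finset.sum_range_succ, add_assoc]
      exact le_trans (by gcongr; exact step T) ih
  unfold expHitTime
  refine ENNReal.tsum_le_of_sum_range_le fun T => ?_
  exact le_trans le_self_add (key T)

noncomputable def mutR (K m : ℕ) (x y : Sol K m) : ℝ :=
  (1 / (K * m : ℝ)) ^ hdist K m x y * (1 - 1 / (K * m : ℝ)) ^ (K * m - hdist K m x y)

theorem inv_bounds (K m : ℕ) (h : 2 ≤ K * m) : 0 < 1 / (K * m : ℝ) ∧ 0 < 1 - 1 / (K * m : ℝ) := by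
  have h2 : (2:ℝ) ≤ K * m := by exact_mod_cast h
  refine ⟨by positivity, ?_⟩
  rw [sub_pos, div_lt_one (by linarith)]
  linarith

theorem mutR_nonneg (K m : ℕ) (h : 2 ≤ K * m) (x y : Sol K m) : 0 ≤ mutR K m x y := by
  obtain ⟨h1, h2⟩ := inv_bounds K m h
  unfold mutR; positivity

theorem mutEA_eq (K m : ℕ) (h : 2 ≤ K * m) (x y : Sol K m) :
    mutEA K m x y = ENNReal.ofReal (mutR K m x y) := by
  obtain ⟨h1, h2⟩ := inv_bounds K m h
  have h0 : (2:ℝ) ≤ K * m := by exact_mod_cast h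
  have e1 : (1 / (K * m : ℝ≥0∞)) = ENNReal.ofReal (1 / (K * m : ℝ)) := by
    rw [ENNReal.ofReal_div_of_pos (by linarith), ENNReal.ofReal_mul (by positivity)]
    simp
  unfold mutEA mutR
  rw [ENNReal.ofReal_mul (by positivity), ENNReal.ofReal_pow h1.le, ENNReal.ofReal_pow h2.le,
    ENNReal.ofReal_sub _ h1.le, ENNReal.ofReal_one, e1]

theorem mutR_prod (K m : ℕ) (x y : Sol K m) :
    mutR K m x y = ∏ i, ∏ j, if x i j = y i j then 1 - 1 / (K * m : ℝ) else 1 / (K * m : ℝ) := by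
  set p := 1 / (K * m : ℝ) with hp
  have hn : hdist K m x y + (∑ i, ∑ j, if x i j = y i j then 1 else 0) = K * m := by
    unfold hdist
    rw [← Finset.sum_add_distrib]
    simp only [← Finset.sum_add_distrib]
    have : ∀ i j, ((if x i j = y i j then 0 else 1) + (if x i j = y i j then 1 else 0) : ℕ) = 1 := by
      intro i j; split_ifs <;> rfl
    simp [this]
  have : K * m - hdist K m x y = (∑ i, ∑ j, if x i j = y i j then 1 else 0) := by omega
  unfold mutR
  rw [this, ← hp]
  unfold hdist
  simp only [← Finset.prod_pow_eq_pow_sum]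
  rw [← Finset.prod_mul_distrib]
  refine Finset.prod_congr rfl fun i _ => ?_
  rw [← Finset.prod_mul_distrib]
  refine Finset.prod_congr rfl fun j _ => ?_
  split_ifs <;> simp

theorem mutR_sum (K m : ℕ) (x : Sol K m) : ∑ y, mutR K m x y = 1 := by
  simp only [mutR_prod]
  set p := 1 / (K * m : ℝ) with hp
  have h1 : ∀ i : Fin K, ∑ yi : Fin m → Bool, ∏ j, (if x i j = yi j then 1 - p else p) = 1 := by
    intro i
    rw [← Fintype.prod_sum (fun j (b : Bool) => if x i j = b then 1 - p else p)]
    refine Finset.prod_eq_one fun j _ => ?_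
    cases x i j <;> simp
  rw [← Fintype.prod_sum (fun i (yi : Fin m → Bool) => ∏ j, (if x i j = yi j then 1 - p else p))]
  exact Finset.prod_eq_one fun i _ => h1 i

theorem step_drift (K m : ℕ) (h : 2 ≤ K * m) (acc : Sol K m → Sol K m → Prop)
    (φ : Sol K m → ℝ) (hφ : ∀ x, 0 ≤ φ x) (x : Sol K m)
    (hmono : ∀ z, acc z x → φ z ≤ φ x)
    {ι : Type*} (S : Finset ι) (f : ι → Sol K m) (hf : Set.InjOn f S)
    (hacc : ∀ s ∈ S, acc (f s) x) (p : ℝ) (hp : 0 ≤ p) (δ : ι → ℝ)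
    (hδ : ∀ s ∈ S, φ (f s) + δ s ≤ φ x) (hδ0 : ∀ s ∈ S, 0 ≤ δ s)
    (hmut : ∀ s ∈ S, p ≤ mutR K m x (f s))
    (hsum : 1 ≤ p * ∑ s ∈ S, δ s) :
    1 + ∑ y, stepP K m (mutEA K m) acc x y * ENNReal.ofReal (φ y) ≤ ENNReal.ofReal (φ x) := by
  classical
  have e1 : ∑ y, stepP K m (mutEA K m) acc x y * ENNReal.ofReal (φ y)
      = ∑ z, ENNReal.ofReal (mutR K m x z * (if acc z x then φ z else φ x)) := by
    unfold stepP
    simp only [add_mul, Finset.sum_add_distrib, ite_mul, zero_mul, Finset.sum_ite_eq',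
      Finset.sum_ite_eq, Finset.mem_univ, if_true]
    rw [Finset.sum_mul, ← Finset.sum_add_distrib]
    refine Finset.sum_congr rfl fun z _ => ?_
    rw [mutEA_eq K m h, ENNReal.ofReal_mul (mutR_nonneg K m h x z)]
    by_cases hz : acc z x <;> simp [hz]
  have hnn : ∀ z, 0 ≤ mutR K m x z * (if acc z x then φ z else φ x) := by
    intro z
    refine mul_nonneg (mutR_nonneg K m h x z) ?_
    split_ifs <;> apply hφ
  rw [e1, ← ENNReal.ofReal_sum_of_nonneg (fun z _ => hnn z), ← ENNReal.ofReal_one,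
    ← ENNReal.ofReal_add zero_le_one (Finset.sum_nonneg fun z _ => hnn z)]
  apply ENNReal.ofReal_le_ofReal
  have e2 : φ x - ∑ z, mutR K m x z * (if acc z x then φ z else φ x)
      = ∑ z, mutR K m x z * (φ x - (if acc z x then φ z else φ x)) := by
    simp only [mul_sub, Finset.sum_sub_distrib, ← Finset.sum_mul, mutR_sum, one_mul]
  have e3 : ∑ s ∈ S, p * δ s ≤ ∑ z, mutR K m x z * (φ x - (if acc z x then φ z else φ x)) := by
    calc ∑ s ∈ S, p * δ s
        ≤ ∑ s ∈ S, mutR K m x (f s) * (φ x - (if acc (f s) x then φ (f s) else φ x)) := by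
          refine Finset.sum_le_sum fun s hs => ?_
          rw [if_pos (hacc s hs)]
          have := hδ s hs
          exact mul_le_mul (hmut s hs) (by linarith) (hδ0 s hs) (mutR_nonneg K m h x _)
      _ = ∑ z ∈ S.image f, mutR K m x z * (φ x - (if acc z x then φ z else φ x)) := by
          rw [Finset.sum_image hf]
      _ ≤ _ := by
          refine Finset.sum_le_univ_sum_of_nonneg fun z => ?_
          refine mul_nonneg (mutR_nonneg K m h x z) ?_
          split_ifs with hz
          · linarith [hmono z hz]
          · simp
  rw [← Finset.mul_sum] at e3
  linarith

theorem pow_bound (n : ℕ) (hn : 2 ≤ n) (k : ℕ) (hk : k ≤ n - 1) :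
    1 / 3 ≤ (1 - 1 / (n : ℝ)) ^ k := by
  have hn' : (2:ℝ) ≤ n := by exact_mod_cast hn
  have h0 : 0 < 1 - 1 / (n:ℝ) := by
    rw [sub_pos, div_lt_one (by linarith)]; linarith
  have h1 : (1 - 1 / (n : ℝ)) ^ (n - 1) ≤ (1 - 1 / (n : ℝ)) ^ k :=
    pow_le_pow_of_le_one h0.le (by simp) hk
  refine le_trans ?_ h1
  obtain ⟨r, rfl⟩ : ∃ r, n = r + 1 := ⟨n - 1, by omega⟩
  have hr : (1:ℝ) ≤ r := by push_cast at hn'; linarith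
  simp only [Nat.add_sub_cancel]
  have e : (1 - 1 / ((r + 1 : ℕ) : ℝ)) = (1 + 1 / (r:ℝ))⁻¹ := by
    push_cast; field_simp; ring
  rw [e, inv_pow]
  have h2 : (1 + 1 / (r:ℝ)) ^ r ≤ Real.exp 1 := by
    have : (1 + 1 / (r:ℝ)) ≤ Real.exp (1 / r) := by
      rw [add_comm]; exact Real.add_one_le_exp _
    calc _ ≤ (Real.exp (1 / r)) ^ r := by gcongr
      _ = Real.exp 1 := by
        rw [← Real.exp_nat_mul]; congr 1; field_simp
  have h3 := Real.exp_one_lt_d9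
  rw [one_div]
  apply inv_anti₀ (by positivity)
  linarith

theorem mutR_one (K m : ℕ) (h : 2 ≤ K * m) (x y : Sol K m) (hd : hdist K m x y = 1) :
    1 / (3 * (K * m : ℝ)) ≤ mutR K m x y := by
  have := pow_bound (K*m) h (K*m-1) le_rfl
  have h0 : (2:ℝ) ≤ K * m := by exact_mod_cast h
  unfold mutR
  rw [hd, pow_one]
  push_cast at this
  calc 1 / (3 * (K * m : ℝ)) = 1 / (K * m : ℝ) * (1/3) := by field_simp
    _ ≤ _ := by gcongr

theorem mutR_two (K m : ℕ) (h : 2 ≤ K * m) (x y : Sol K m) (hd : hdist K m x y = 2) :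
    1 / (3 * (K * m : ℝ) ^ 2) ≤ mutR K m x y := by
  have := pow_bound (K*m) h (K*m-2) (by omega)
  have h0 : (2:ℝ) ≤ K * m := by exact_mod_cast h
  unfold mutR
  rw [hd]
  push_cast at this
  calc 1 / (3 * (K * m : ℝ) ^ 2) = (1 / (K * m : ℝ)) ^ 2 * (1/3) := by field_simp
    _ ≤ _ := by gcongr

def grp {K m : ℕ} (x : Sol K m) (i : Fin K) : ℕ := ∑ j, if x i j then 1 else 0

def sqs {K m : ℕ} (x : Sol K m) : ℕ := ∑ i, grp x i ^ 2

def flipb {K m : ℕ} (x : Sol K m) (s : Fin K × Fin m) : Sol K m :=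
  fun i j => if (i, j) = s then !x i j else x i j

theorem numOnes_eq {K m : ℕ} (x : Sol K m) : numOnes K m x = ∑ i, grp x i := rfl

theorem grp_le {K m : ℕ} (x : Sol K m) (i : Fin K) : grp x i ≤ m := by
  unfold grp
  calc _ ≤ ∑ j : Fin m, 1 := Finset.sum_le_sum fun j _ => by split_ifs <;> simp
    _ = m := by simp

theorem numOnes_le {K m : ℕ} (x : Sol K m) : numOnes K m x ≤ K * m := by
  rw [numOnes_eq]
  calc _ ≤ ∑ i : Fin K, m := Finset.sum_le_sum fun i _ => grp_le x i
    _ = K * m := by simp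

theorem numOnes_le_sqs {K m : ℕ} (x : Sol K m) : numOnes K m x ≤ sqs x := by
  rw [numOnes_eq]
  exact Finset.sum_le_sum fun i _ => Nat.le_self_pow (by norm_num) _

theorem sqs_le {K m : ℕ} (x : Sol K m) : sqs x ≤ numOnes K m x ^ 2 := by
  rw [numOnes_eq, sq, Finset.sum_mul]
  refine Finset.sum_le_sum fun i _ => ?_
  rw [sq]
  gcongr
  exact Finset.single_le_sum (f := grp x) (fun _ _ => Nat.zero_le _) (Finset.mem_univ i)

theorem pair_sum (m : ℕ) (v : Fin m → ℝ) (hv : ∀ j, v j * v j = v j) :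
    2 * ∑ p ∈ Finset.univ.filter (fun p : Fin m × Fin m => p.1 < p.2), v p.1 * v p.2
      = (∑ j, v j) ^ 2 - ∑ j, v j := by
  classical
  have h1 : (∑ j, v j) ^ 2 = ∑ p : Fin m × Fin m, v p.1 * v p.2 := by
    rw [sq, Finset.sum_mul_sum, ← Finset.univ_product_univ, Finset.sum_product]
  have h2 : ∀ p : Fin m × Fin m, v p.1 * v p.2
      = (if p.1 < p.2 then v p.1 * v p.2 else 0) + (if p.2 < p.1 then v p.1 * v p.2 else 0)
        + (if p.1 = p.2 then v p.1 else 0) := by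
    intro p
    rcases lt_trichotomy p.1 p.2 with h | h | h
    · simp [h, h.ne, h.le]
    · simp [h, hv]
    · simp [h, h.ne', h.le]
  have h3 : ∑ p : Fin m × Fin m, (if p.2 < p.1 then v p.1 * v p.2 else 0)
      = ∑ p : Fin m × Fin m, (if p.1 < p.2 then v p.1 * v p.2 else 0) := by
    refine Fintype.sum_equiv (Equiv.prodComm _ _) _ _ fun p => ?_
    simp [mul_comm]
  have h4 : ∑ p : Fin m × Fin m, (if p.1 = p.2 then v p.1 else 0) = ∑ j, v j := by
    rw [← Finset.univ_product_univ, Finset.sum_product]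
    simp
  have h5 : ∑ p : Fin m × Fin m, v p.1 * v p.2
      = ∑ p : Fin m × Fin m, (if p.1 < p.2 then v p.1 * v p.2 else 0)
        + ∑ p : Fin m × Fin m, (if p.1 < p.2 then v p.1 * v p.2 else 0) + ∑ j, v j := by
    conv_lhs => rw [Finset.sum_congr rfl (fun p _ => h2 p)]
    rw [Finset.sum_add_distrib, Finset.sum_add_distrib, h3, h4]
  rw [h1, h5, Finset.sum_filter]
  ring

theorem cova_eq {K m : ℕ} (c : ℝ) (x : Sol K m) :
    cova K m c x = c * ((sqs x : ℝ) - numOnes K m x) := by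
  have h : ∀ i, 2 * ∑ p ∈ Finset.univ.filter (fun p : Fin m × Fin m => p.1 < p.2),
      (if x i p.1 then (1 : ℝ) else 0) * (if x i p.2 then (1 : ℝ) else 0)
      = (grp x i : ℝ) ^ 2 - grp x i := by
    intro i
    rw [pair_sum m (fun j => if x i j then (1:ℝ) else 0) (fun j => by split_ifs <;> simp)]
    simp [grp]
  unfold cova
  rw [mul_comm 2 c, mul_assoc, Finset.mul_sum, Finset.sum_congr rfl (fun i _ => h i),
    Finset.sum_sub_distrib, numOnes_eq, sqs]
  push_cast
  rfl

theorem flipb_flipb {K m : ℕ} (x : Sol K m) (s : Fin K × Fin m) : flipb (flipb x s) s = x := by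
  funext i j
  simp only [flipb]
  split_ifs <;> simp

theorem grp_down {K m : ℕ} (x : Sol K m) (s : Fin K × Fin m) (h : x s.1 s.2 = true) (k : Fin K) :
    grp x k = grp (flipb x s) k + if k = s.1 then 1 else 0 := by
  obtain ⟨a, b⟩ := s
  by_cases hk : k = a
  · subst hk
    simp only [grp, flipb, if_true]
    have e : ∀ j : Fin m, (if x k j then 1 else 0)
        = ((if (if (k, j) = (k, b) then !x k j else x k j) = true then 1 else 0) 
          + if j = b then 1 else 0 : ℕ) := by
      intro j
      by_cases hj : j = b
      · subst hj; simp at h; simp [h]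
      · simp [hj]
    rw [Finset.sum_congr rfl (fun j _ => e j), Finset.sum_add_distrib]
    simp
  · simp [grp, flipb, hk]

theorem grp_up {K m : ℕ} (x : Sol K m) (s : Fin K × Fin m) (h : x s.1 s.2 = false) (k : Fin K) :
    grp (flipb x s) k = grp x k + if k = s.1 then 1 else 0 := by
  have := grp_down (flipb x s) s (by simp [flipb, h]) k
  rwa [flipb_flipb] at this

theorem ones_down {K m : ℕ} (x : Sol K m) (s : Fin K × Fin m) (h : x s.1 s.2 = true) :
    numOnes K m x = numOnes K m (flipb x s) + 1 := by
  rw [numOnes_eq, numOnes_eq, Finset.sum_congr rfl (fun k _ => grp_down x s h k),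
    Finset.sum_add_distrib]
  simp

theorem ones_up {K m : ℕ} (x : Sol K m) (s : Fin K × Fin m) (h : x s.1 s.2 = false) :
    numOnes K m (flipb x s) = numOnes K m x + 1 := by
  have := ones_down (flipb x s) s (by simp [flipb, h])
  rwa [flipb_flipb] at this

theorem sqs_up {K m : ℕ} (x : Sol K m) (s : Fin K × Fin m) (h : x s.1 s.2 = false) :
    sqs (flipb x s) = sqs x + 2 * grp x s.1 + 1 := by
  unfold sqs
  have e : ∀ k, grp (flipb x s) k ^ 2 = grp x k ^ 2 + if k = s.1 then 2 * grp x s.1 + 1 else 0 := by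
    intro k
    rw [grp_up x s h k]
    by_cases hk : k = s.1
    · subst hk; simp; ring
    · simp [hk]
  rw [Finset.sum_congr rfl (fun k _ => e k), Finset.sum_add_distrib]
  simp
  ring

theorem sqs_down {K m : ℕ} (x : Sol K m) (s : Fin K × Fin m) (h : x s.1 s.2 = true) :
    sqs x + 1 = sqs (flipb x s) + 2 * grp x s.1 := by
  have := sqs_up (flipb x s) s (by simp [flipb, h])
  rw [flipb_flipb] at this
  have h2 := grp_down x s h s.1
  simp at h2
  omega

theorem hdist_flip {K m : ℕ} (x : Sol K m) (s : Fin K × Fin m) : hdist K m x (flipb x s) = 1 := by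
  obtain ⟨a, b⟩ := s
  unfold hdist flipb
  have e : ∀ i j, (if x i j = (if (i, j) = (a, b) then !x i j else x i j) then 0 else 1 : ℕ)
      = if i = a then (if j = b then 1 else 0) else 0 := by
    intro i j
    by_cases hi : i = a <;> by_cases hj : j = b <;> simp [hi, hj]
  simp only [e]
  simp

theorem hdist_swap {K m : ℕ} (x : Sol K m) (s t : Fin K × Fin m) (hst : s ≠ t) :
    hdist K m x (flipb (flipb x s) t) = 2 := by
  unfold hdist flipb
  have e : ∀ i j, (if x i j = (if (i, j) = t then !(if (i, j) = s then !x i j else x i j)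
      else (if (i, j) = s then !x i j else x i j)) then 0 else 1 : ℕ)
      = (if (i, j) = s then 1 else 0) + (if (i, j) = t then 1 else 0) := by
    intro i j
    by_cases hi : (i, j) = s
    · have : (i, j) ≠ t := by rw [hi]; exact hst
      simp [hi, hst]
    · by_cases hj : (i, j) = t
      · simp [hj, hst.symm]
      · simp [hi, hj]
  have e2 : ∀ s : Fin K × Fin m, ∑ i, ∑ j, (if (i, j) = s then 1 else 0 : ℕ) = 1 := by
    intro s
    rw [← Finset.sum_product' (f := fun i j => (if (i, j) = s then 1 else 0 : ℕ))]
    simp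
  simp only [e, Finset.sum_add_distrib, e2]

theorem flip_inj {K m : ℕ} (x : Sol K m) : Function.Injective (flipb x) := by
  intro s t h
  by_contra hst
  have h1 := congrFun (congrFun h s.1) s.2
  simp [flipb, hst] at h1

theorem swap_inj {K m : ℕ} (x : Sol K m) :
    Set.InjOn (fun p : (Fin K × Fin m) × (Fin K × Fin m) => flipb (flipb x p.1) p.2)
      {p | x p.1.1 p.1.2 = true ∧ x p.2.1 p.2.2 = false} := by
  rintro ⟨s, t⟩ ⟨hs, ht⟩ ⟨s', t'⟩ ⟨hs', ht'⟩ h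
  simp only at hs ht hs' ht' h
  have n1 : s ≠ t := by rintro rfl; simp [hs] at ht
  have n2 : s ≠ t' := by rintro rfl; simp [hs] at ht'
  have n3 : s' ≠ t := by rintro rfl; simp [hs'] at ht
  have hss : s = s' := by
    by_contra hne
    have h1 := congrFun (congrFun h s.1) s.2
    simp [flipb, hne, n1, n2] at h1
  subst hss
  have := flip_inj _ h
  rw [this]

theorem comb1 (L k : ℤ) (h : k ≤ k ^ 2) :
    L ^ 2 - L - ((L + k) ^ 2 - (L + k)) ≤ 2 * (0 * (L - 1) - k * L) := by
  ring_nf; linarith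

theorem comb2 (b k : ℤ) (h : k ≤ k ^ 2) :
    (b + k) ^ 2 - (b + k) - (b ^ 2 - b) ≤ 2 * (k * (b + k - 1) - 0 * (b + k)) := by
  ring_nf; linarith

set_option maxHeartbeats 1000000 in
theorem comb {K m : ℕ} (L b : Fin K → ℕ) (hb : ∀ i, b i ≤ m)
    (hsum : ∑ i, L i = ∑ i, b i) (hsq : ∑ i, b i ^ 2 ≤ ∑ i, L i ^ 2) :
    (∑ i, L i ^ 2) - ∑ i, b i ^ 2 ≤ ∑ i, ∑ j, L i * ((m - L j) * (2 * (L i - L j - 1))) := by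
  set s : Fin K → ℕ := fun i => L i - b i with hs
  set t : Fin K → ℕ := fun i => b i - L i with ht
  have hst : ∑ i, s i = ∑ i, t i := by
    have h1 : ∑ i, (s i + b i) = ∑ i, (t i + L i) :=
      Finset.sum_congr rfl fun i _ => by simp only [hs, ht]; omega
    rw [Finset.sum_add_distrib, Finset.sum_add_distrib] at h1
    omega
  rcases Nat.eq_zero_or_pos (∑ i, s i) with hD | hD
  · have h1 : ∀ i, s i = 0 := by
      intro i; exact (Finset.sum_eq_zero_iff.mp hD) i (Finset.mem_univ i)
    have h2 : ∀ i, t i = 0 := by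
      intro i; exact (Finset.sum_eq_zero_iff.mp (hst ▸ hD)) i (Finset.mem_univ i)
    have h3 : ∀ i, L i = b i := by
      intro i
      have := h1 i; have := h2 i
      simp only [hs, ht] at *; omega
    simp [h3]
  · have hle : ∑ i, ∑ j, s i * (t j * (2 * (L i - L j - 1)))
        ≤ ∑ i, ∑ j, L i * ((m - L j) * (2 * (L i - L j - 1))) := by
      refine Finset.sum_le_sum fun i _ => Finset.sum_le_sum fun j _ => ?_
      have := hb j
      gcongr
      · simp [hs]
      · simp only [ht]; omega
    refine le_trans ?_ hle
    zify [hsq]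
    have hint : ∑ i, ∑ j, (s i : ℤ) * (t j * (2 * ((L i : ℤ) - L j - 1)))
        ≤ ∑ i, ∑ j, (s i : ℤ) * (t j * (2 * ((L i - L j - 1 : ℕ) : ℤ))) := by
      refine Finset.sum_le_sum fun i _ => Finset.sum_le_sum fun j _ => ?_
      gcongr
      omega
    refine le_trans ?_ hint
    have hst' : ∑ i, (s i : ℤ) = ∑ i, (t i : ℤ) := by exact_mod_cast hst
    set D : ℤ := ∑ i, (s i : ℤ) with hDdef
    have hD1 : 1 ≤ D := by rw [hDdef]; exact_mod_cast hD
    have hfac : ∑ i, ∑ j, (s i : ℤ) * (t j * (2 * ((L i : ℤ) - L j - 1)))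
        = D * ∑ i, (2 * ((s i : ℤ) * (L i - 1) - t i * L i)) := by
      have e : ∀ i j, (s i : ℤ) * (t j * (2 * ((L i : ℤ) - L j - 1)))
          = (s i : ℤ) * (2 * (L i - 1)) * t j - s i * (2 * t j * L j) := by
        intro i j; ring
      simp only [e, Finset.sum_sub_distrib, ← Finset.mul_sum, ← Finset.sum_mul]
      rw [← hst', ← hDdef, Finset.sum_congr rfl (fun i _ => show (s i : ℤ) * (2 * (L i - 1))
        = 2 * (s i * (L i - 1)) by ring), ← Finset.mul_sum,
        Finset.sum_congr rfl (fun i _ => show 2 * (t i : ℤ) * L i = 2 * (t i * L i) by ring),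
        ← Finset.mul_sum]
      ring
    rw [hfac]
    have hgap : ∑ i, (L i : ℤ) ^ 2 - ∑ i, (b i : ℤ) ^ 2
        ≤ ∑ i, (2 * ((s i : ℤ) * (L i - 1) - t i * L i)) := by
      have hsum' : ∑ i, (L i : ℤ) = ∑ i, (b i : ℤ) := by exact_mod_cast hsum
      have : ∑ i, (((L i : ℤ) ^ 2 - L i) - ((b i : ℤ) ^ 2 - b i))
        ≤ ∑ i, (2 * ((s i : ℤ) * (L i - 1) - t i * L i)) := by
        refine Finset.sum_le_sum fun i _ => ?_
        rcases le_total (L i) (b i) with h | h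
        · obtain ⟨k, hk⟩ := Nat.exists_eq_add_of_le h
          have e1 : s i = 0 := by simp only [hs]; omega
          have e2 : t i = k := by simp only [ht]; omega
          have hk2 : (k:ℤ) ≤ k ^ 2 := by exact_mod_cast Nat.le_self_pow (by norm_num) k
          rw [e1, e2, hk]; push_cast; exact comb1 _ _ hk2
        · obtain ⟨k, hk⟩ := Nat.exists_eq_add_of_le h
          have e1 : s i = k := by simp only [hs]; omega
          have e2 : t i = 0 := by simp only [ht]; omega
          have hk2 : (k:ℤ) ≤ k ^ 2 := by exact_mod_cast Nat.le_self_pow (by norm_num) k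
          rw [e1, e2, hk]; push_cast; exact comb2 _ _ hk2
      rw [Finset.sum_sub_distrib, Finset.sum_sub_distrib, Finset.sum_sub_distrib, hsum'] at this
      simpa using this
    have hnn : (0:ℤ) ≤ ∑ i, (L i : ℤ) ^ 2 - ∑ i, (b i : ℤ) ^ 2 := by
      have : (∑ i, (b i : ℤ) ^ 2) ≤ ∑ i, (L i : ℤ) ^ 2 := by exact_mod_cast hsq
      linarith
    exact le_trans hgap (le_mul_of_one_le_left (le_trans hnn hgap) hD1)

theorem swap_sum {K m : ℕ} (x : Sol K m) (g : Fin K → Fin K → ℕ) :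
    ∑ p ∈ Finset.univ.filter (fun p : (Fin K × Fin m) × (Fin K × Fin m) =>
        x p.1.1 p.1.2 = true ∧ x p.2.1 p.2.2 = false ∧ 0 < g p.1.1 p.2.1), g p.1.1 p.2.1
      = ∑ i, ∑ j, grp x i * ((m - grp x j) * g i j) := by
  have hz : ∀ j, m - grp x j = ∑ b, if x j b = false then 1 else 0 := by
    intro j
    have : grp x j + (∑ b, if x j b = false then 1 else 0) = m := by
      unfold grp
      rw [← Finset.sum_add_distrib]
      have e : ∀ b, ((if x j b = true then 1 else 0) + (if x j b = false then 1 else 0) : ℕ) = 1 := by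
        intro b; cases x j b <;> simp
      simp [e]
    omega
  rw [Finset.sum_filter]
  simp only [Fintype.sum_prod_type]
  refine Finset.sum_congr rfl fun i _ => ?_
  rw [Finset.sum_comm]
  refine Finset.sum_congr rfl fun j _ => ?_
  rw [hz, grp, Finset.sum_mul]
  refine Finset.sum_congr rfl fun a _ => ?_
  rw [Finset.sum_mul, Finset.mul_sum]
  refine Finset.sum_congr rfl fun b _ => ?_
  rcases Nat.eq_zero_or_pos (g i j) with h | h
  · simp [h]
  · cases x i a <;> cases x j b <;> simp [h]

noncomputable def bfun (a d c B : ℝ) (l q : ℕ) : ℝ :=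
  if a * l < B then (d * l + c * ((q:ℝ) - l)) / ((d * l + c * ((q:ℝ) - l)) + (B - a * l) ^ 2)
  else 1 + a * l - B

theorem betaPrime_eq {K m : ℕ} (a d c B : ℝ) (x : Sol K m) :
    betaPrime K m a d c B x = bfun a d c B (numOnes K m x) (sqs x) := by
  unfold betaPrime bfun chebBeta varWeight expWeight
  rw [cova_eq]

theorem feas_iff {K m : ℕ} (a d c B α : ℝ) (hα : α < 1) (x : Sol K m) :
    feasible K m a d c B α x ↔ betaPrime K m a d c B x ≤ α := by
  unfold feasible betaPrime
  split_ifs with h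
  · simp [h]
  · simp only [h, false_and, false_iff, not_le]
    push Not at h
    linarith

theorem pPrime_eq {K m : ℕ} (a d c B α : ℝ) (x : Sol K m) :
    pPrime K m a d c B α (fun _ _ => 1) x =
      if betaPrime K m a d c B x ≤ α then (numOnes K m x : ℝ) else -1 := by
  unfold pPrime profitOf numOnes
  by_cases h : betaPrime K m a d c B x ≤ α
  · simp [h, not_lt.mpr h]
  · simp [h, not_le.mp h]

theorem ratio_lt (V V' D D' : ℝ) (hV' : 0 ≤ V') (hV : V' < V) (hD : 0 < D) (hD' : D ≤ D') :
    V' / (V' + D') < V / (V + D) := by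
  rw [div_lt_div_iff₀ (by linarith) (by linarith)]
  nlinarith [mul_lt_mul_of_pos_right hV hD, mul_le_mul_of_nonneg_left hD' (hV'.trans hV.le)]

theorem ratio_lt_one (V D : ℝ) (hV : 0 ≤ V) (hD : 0 < D) : V / (V + D) < 1 := by
  rw [div_lt_one (by linarith)]; linarith

section
variable {K m : ℕ} {a d c B α : ℝ}

theorem beta_down (ha : 0 < a) (hd : 0 < d) (hc : 0 < c) (x : Sol K m) (s : Fin K × Fin m)
    (h : x s.1 s.2 = true) :
    betaPrime K m a d c B (flipb x s) < betaPrime K m a d c B x := by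
  rw [betaPrime_eq, betaPrime_eq]
  have h1 := ones_down x s h
  have h2 := sqs_down x s h
  have h3 := grp_down x s h s.1
  have h4 := numOnes_le_sqs (flipb x s)
  simp at h3
  set l' := numOnes K m (flipb x s)
  set q' := sqs (flipb x s)
  have hq : (sqs x : ℝ) + 1 = q' + 2 * grp x s.1 := by exact_mod_cast h2
  have hg : (1:ℝ) ≤ grp x s.1 := by
    have : 1 ≤ grp x s.1 := by omega
    exact_mod_cast this
  have h4' : (l' : ℝ) ≤ q' := by exact_mod_cast h4
  rw [h1]
  unfold bfun
  push_cast
  have hl0 : (0:ℝ) ≤ l' := by positivity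
  have hV' : 0 ≤ d * l' + c * ((q':ℝ) - l') := by
    have : 0 ≤ (q':ℝ) - l' := by linarith
    positivity
  have hV : d * l' + c * ((q':ℝ) - l') < d * (l' + 1) + c * ((sqs x:ℝ) - (l' + 1)) := by
    have : c * ((q':ℝ) - l') ≤ c * ((sqs x:ℝ) - (l' + 1)) := by
      apply mul_le_mul_of_nonneg_left _ hc.le; linarith
    linarith
  by_cases hB : a * ((l':ℝ) + 1) < B
  · have hB' : a * (l':ℝ) < B := by linarith
    rw [if_pos hB, if_pos hB']
    refine ratio_lt _ _ _ _ hV' hV (by have : 0 < B - a * (l' + 1) := by linarith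
                                       positivity) ?_
    have : 0 < B - a * ((l':ℝ) + 1) := by linarith
    gcongr
    linarith
  · rw [if_neg hB]
    split_ifs with hB'
    · have := ratio_lt_one _ ((B - a * (l':ℝ)) ^ 2) hV' (by
        have : 0 < B - a * l' := by linarith
        positivity)
      linarith
    · linarith

theorem beta_same_lt (hd : 0 < d) (hc : 0 < c) (x y : Sol K m) (hl : numOnes K m y = numOnes K m x)
    (hB : a * (numOnes K m x : ℝ) < B) (hq : sqs y < sqs x) :
    betaPrime K m a d c B y < betaPrime K m a d c B x := by
  rw [betaPrime_eq, betaPrime_eq, hl]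
  unfold bfun
  rw [if_pos hB, if_pos hB]
  have h4 := numOnes_le_sqs y
  rw [hl] at h4
  have h4' : (numOnes K m x : ℝ) ≤ sqs y := by exact_mod_cast h4
  have hq' : (sqs y : ℝ) < sqs x := by exact_mod_cast hq
  refine ratio_lt _ _ _ _ ?_ ?_ ?_ le_rfl
  · have : 0 ≤ (sqs y:ℝ) - numOnes K m x := by linarith
    positivity
  · gcongr
  · have : 0 < B - a * numOnes K m x := by linarith
    positivity

theorem beta_same_le (hd : 0 < d) (hc : 0 < c) (x y : Sol K m) (hl : numOnes K m y = numOnes K m x)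
    (hB : a * (numOnes K m x : ℝ) < B) (hq : sqs y ≤ sqs x) :
    betaPrime K m a d c B y ≤ betaPrime K m a d c B x := by
  rcases hq.lt_or_eq with h | h
  · exact (beta_same_lt hd hc x y hl hB h).le
  · rw [betaPrime_eq, betaPrime_eq, hl, h]

theorem exists_one (x : Sol K m) (h : 0 < numOnes K m x) : ∃ s : Fin K × Fin m, x s.1 s.2 = true := by
  by_contra hc
  push Not at hc
  have : numOnes K m x = 0 := by
    unfold numOnes
    refine Finset.sum_eq_zero fun i _ => Finset.sum_eq_zero fun j _ => ?_
    simp [hc (i, j)]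
  omega

theorem descend (ha : 0 < a) (hd : 0 < d) (hc : 0 < c) (l : ℕ) :
    ∀ k, ∀ z : Sol K m, numOnes K m z = l + k → betaPrime K m a d c B z ≤ α →
      ∃ z' : Sol K m, numOnes K m z' = l ∧ betaPrime K m a d c B z' ≤ α := by
  intro k
  induction k with
  | zero => intro z h1 h2; exact ⟨z, h1, h2⟩
  | succ k ih =>
    intro z h1 h2
    obtain ⟨s, hs⟩ := exists_one z (by omega)
    have := ones_down z s hs
    exact ih (flipb z s) (by omega) ((beta_down ha hd hc z s hs).le.trans h2)
end

noncomputable def qmin (K m l : ℕ) : ℕ := sInf {q | ∃ z : Sol K m, numOnes K m z = l ∧ sqs z = q}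

theorem qmin_le {K m : ℕ} (x : Sol K m) : qmin K m (numOnes K m x) ≤ sqs x :=
  Nat.sInf_le ⟨x, rfl, rfl⟩

theorem qmin_ex {K m : ℕ} (x : Sol K m) :
    ∃ z : Sol K m, numOnes K m z = numOnes K m x ∧ sqs z = qmin K m (numOnes K m x) :=
  Nat.sInf_mem (s := {q | ∃ z : Sol K m, numOnes K m z = numOnes K m x ∧ sqs z = q})
    ⟨sqs x, x, rfl, rfl⟩

noncomputable def gap {K m : ℕ} (x : Sol K m) : ℕ := sqs x - qmin K m (numOnes K m x)

/-- If `x` is of minimal square sum and `z` has one more element, some one-bit extension of `x`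
is at least as good as `z`. -/
theorem extend {K m : ℕ} (x z : Sol K m) (hg : gap x = 0)
    (hz : numOnes K m z = numOnes K m x + 1) :
    ∃ s : Fin K × Fin m, x s.1 s.2 = false ∧ sqs (flipb x s) ≤ sqs z := by
  have hx : sqs x = qmin K m (numOnes K m x) := by
    have := qmin_le x
    unfold gap at hg; omega
  obtain ⟨s0, hs0⟩ := exists_one z (by omega)
  obtain ⟨i, _, hi⟩ := Finset.exists_max_image Finset.univ (grp z) ⟨s0.1, Finset.mem_univ _⟩
  have hi1 : 0 < grp z i := by
    have h1 := grp_down z s0 hs0 s0.1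
    have h2 := hi s0.1 (Finset.mem_univ _)
    simp at h1; omega
  obtain ⟨b, hb⟩ : ∃ b, z i b = true := by
    by_contra hc
    push Not at hc
    have : grp z i = 0 := Finset.sum_eq_zero fun j _ => by simp [hc j]
    omega
  have hd1 := ones_down z (i, b) hb
  have hd2 := sqs_down z (i, b) hb
  have hd3 := qmin_le (flipb z (i, b))
  have e : numOnes K m (flipb z (i, b)) = numOnes K m x := by omega
  rw [e, ← hx] at hd3
  obtain ⟨j, _, hj⟩ : ∃ j ∈ Finset.univ, grp x j < grp z j := by
    apply Finset.exists_lt_of_sum_lt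
    rw [← numOnes_eq, ← numOnes_eq]; omega
  have hj2 := hi j (Finset.mem_univ _)
  obtain ⟨t, ht⟩ : ∃ t, x j t = false := by
    by_contra hc
    push Not at hc
    have : grp x j = m := by simp [grp, hc]
    have := grp_le z j
    omega
  refine ⟨(j, t), ht, ?_⟩
  have := sqs_up x (j, t) ht
  simp only at *
  omega

theorem sqs_swap {K m : ℕ} (x : Sol K m) (s t : Fin K × Fin m) (hs : x s.1 s.2 = true)
    (ht : x t.1 t.2 = false) (hg : 0 < 2 * (grp x s.1 - grp x t.1 - 1)) :
    numOnes K m (flipb (flipb x s) t) = numOnes K m x ∧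
      sqs (flipb (flipb x s) t) + 2 * (grp x s.1 - grp x t.1 - 1) = sqs x := by
  have hne : t.1 ≠ s.1 := by
    intro h; rw [h] at hg; omega
  have hne' : t ≠ s := fun h => hne (by rw [h])
  have ht' : flipb x s t.1 t.2 = false := by simp [flipb, hne', ht]
  have h1 := ones_down x s hs
  have h2 := sqs_down x s hs
  have h3 := ones_up (flipb x s) t ht'
  have h4 := sqs_up (flipb x s) t ht'
  have h5 := grp_down x s hs t.1
  simp [hne] at h5
  omega

theorem harm_drop (k : ℕ) (hk : 0 < k) (k' : ℕ) : ∀ j, k' + j ≤ k →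
    ((harmonic k' : ℚ) : ℝ) + j / k ≤ ((harmonic (k' + j) : ℚ) : ℝ) := by
  intro j
  induction j with
  | zero => intro _; simp
  | succ j ih =>
    intro h
    have := ih (by omega)
    rw [← add_assoc, harmonic_succ]
    push_cast
    have hk' : (0:ℝ) < k := by exact_mod_cast hk
    have h2 : (1:ℝ) / k ≤ ((k':ℝ) + j + 1)⁻¹ := by
      rw [one_div]
      apply inv_anti₀ (by positivity)
      exact_mod_cast h
    rw [add_div]
    linarith

theorem harm_mono {k k' : ℕ} (h : k' ≤ k) : ((harmonic k' : ℚ) : ℝ) ≤ ((harmonic k : ℚ) : ℝ) := by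
  rcases Nat.eq_zero_or_pos k with h0 | h0
  · have : k' = k := by omega
    rw [this]
  · have := harm_drop k h0 k' (k - k') (by omega)
    rw [show k' + (k - k') = k by omega] at this
    have : (0:ℝ) ≤ ((k - k' : ℕ):ℝ) / k := by positivity
    linarith

theorem harm_nonneg (k : ℕ) : 0 ≤ ((harmonic k : ℚ) : ℝ) := by
  have := harm_mono (Nat.zero_le k)
  simpa using this

def grid (n : ℕ) : Finset (Σ _ : ℕ, ℕ) := (Finset.Icc 1 n).sigma fun l => Finset.range (l ^ 2 + 1)

open scoped Classical in
noncomputable def gsum (a d c B : ℝ) (n : ℕ) (b : ℝ) : ℝ :=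
  ∑ p ∈ (grid n).filter (fun p => bfun a d c B p.1 p.2 ≤ b), 3 * (n:ℝ) / p.1

theorem gsum_mono (a d c B : ℝ) (n : ℕ) {b b' : ℝ} (h : b' ≤ b) :
    gsum a d c B n b' ≤ gsum a d c B n b := by
  classical
  unfold gsum
  apply Finset.sum_le_sum_of_subset_of_nonneg
  · intro p hp
    simp only [Finset.mem_filter] at *
    exact ⟨hp.1, hp.2.trans h⟩
  · intros; positivity

theorem gsum_nonneg (a d c B : ℝ) (n : ℕ) (b : ℝ) : 0 ≤ gsum a d c B n b :=
  Finset.sum_nonneg fun _ _ => by positivity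

theorem gsum_drop (a d c B : ℝ) (n : ℕ) (l q : ℕ) (hl : 1 ≤ l) (hln : l ≤ n) (hq : q ≤ l ^ 2)
    {b' : ℝ} (h : b' < bfun a d c B l q) :
    gsum a d c B n b' + 3 * (n:ℝ) / l ≤ gsum a d c B n (bfun a d c B l q) := by
  classical
  unfold gsum
  have hni : (⟨l, q⟩ : Σ _ : ℕ, ℕ) ∉ (grid n).filter (fun p => bfun a d c B p.1 p.2 ≤ b') := by
    simp [h]
  rw [add_comm]
  have hins := Finset.sum_insert (f := fun p : (Σ _ : ℕ, ℕ) => 3 * (n:ℝ) / p.1) hni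
  refine le_trans (le_of_eq hins.symm) ?_
  apply Finset.sum_le_sum_of_subset_of_nonneg
  · intro p hp
    rw [Finset.mem_insert] at hp
    rcases hp with rfl | hp
    · simp [grid]; omega
    · simp only [Finset.mem_filter] at *
      exact ⟨hp.1, hp.2.trans h.le⟩
  · intros; positivity

theorem gsum_le (a d c B : ℝ) (n : ℕ) (b : ℝ) : gsum a d c B n b ≤ 6 * (n:ℝ) ^ 3 := by
  classical
  unfold gsum
  calc _ ≤ ∑ p ∈ grid n, 3 * (n:ℝ) / p.1 := by
        apply Finset.sum_le_sum_of_subset_of_nonneg (Finset.filter_subset _ _)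
        intros; positivity
    _ = ∑ l ∈ Finset.Icc 1 n, ∑ q ∈ Finset.range (l ^ 2 + 1), 3 * (n:ℝ) / l := by
        unfold grid; rw [Finset.sum_sigma]
    _ ≤ ∑ l ∈ Finset.Icc 1 n, 6 * (n:ℝ) ^ 2 := by
        refine Finset.sum_le_sum fun l hl => ?_
        rw [Finset.mem_Icc] at hl
        have h1 : (1:ℝ) ≤ l := by exact_mod_cast hl.1
        have h2 : (l:ℝ) ≤ n := by exact_mod_cast hl.2
        simp only [Finset.sum_const, Finset.card_range, nsmul_eq_mul]
        push_cast
        rw [mul_div_assoc', div_le_iff₀ (by linarith)]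
        have h3 : (l:ℝ) ^ 2 + 1 ≤ 2 * (n * l) := by nlinarith
        calc ((l:ℝ) ^ 2 + 1) * (3 * n) ≤ (2 * (n * l)) * (3 * n) := by gcongr
          _ = _ := by ring
    _ = 6 * (n:ℝ) ^ 3 := by
        simp; ring

noncomputable def Wc (n : ℕ) : ℝ := 3 * (n:ℝ) ^ 2
noncomputable def Mc (n : ℕ) : ℝ := Wc n * ((harmonic (n ^ 2) : ℚ) : ℝ) + Wc n

noncomputable def phiF {K m : ℕ} (x : Sol K m) : ℝ :=
  ((K * m : ℕ) - (numOnes K m x : ℝ)) * Mc (K * m) + Wc (K * m) * ((harmonic (gap x) : ℚ) : ℝ)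

open scoped Classical in
noncomputable def phi {K m : ℕ} (a d c B α : ℝ) (x : Sol K m) : ℝ :=
  if betaPrime K m a d c B x ≤ α then phiF x
  else ((K * m : ℕ) + 1) * Mc (K * m) + gsum a d c B (K * m) (betaPrime K m a d c B x)

theorem Wc_nonneg (n : ℕ) : 0 ≤ Wc n := by unfold Wc; positivity
theorem Mc_nonneg (n : ℕ) : 0 ≤ Mc n := by
  have := Wc_nonneg n
  have := harm_nonneg (n ^ 2)
  unfold Mc; positivity

theorem gap_le {K m : ℕ} (x : Sol K m) : gap x ≤ (K * m) ^ 2 := by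
  have h1 := sqs_le x
  have h2 := Nat.pow_le_pow_left (numOnes_le x) 2
  unfold gap; omega

theorem WH_le {K m : ℕ} (x : Sol K m) :
    Wc (K * m) * ((harmonic (gap x) : ℚ) : ℝ) + Wc (K * m) ≤ Mc (K * m) := by
  unfold Mc
  have := Wc_nonneg (K * m)
  have := harm_mono (gap_le x)
  gcongr

theorem phiF_nonneg {K m : ℕ} (x : Sol K m) : 0 ≤ phiF x := by
  have h1 : (numOnes K m x : ℝ) ≤ (K * m : ℕ) := by exact_mod_cast numOnes_le x
  have h2 := Wc_nonneg (K * m)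
  have h3 := Mc_nonneg (K * m)
  have h4 := harm_nonneg (gap x)
  unfold phiF
  have : 0 ≤ ((K * m : ℕ) : ℝ) - numOnes K m x := by linarith
  positivity

theorem phiF_le {K m : ℕ} (x : Sol K m) : phiF x ≤ ((K * m : ℕ) + 1) * Mc (K * m) := by
  have h2 := Wc_nonneg (K * m)
  have h3 := Mc_nonneg (K * m)
  have h4 := WH_le x
  have h5 : 0 ≤ (numOnes K m x : ℝ) * Mc (K * m) := by positivity
  unfold phiF
  linarith

theorem phiF_lt {K m : ℕ} (x y : Sol K m) (h : numOnes K m x + 1 ≤ numOnes K m y) :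
    phiF y + Wc (K * m) ≤ phiF x := by
  have h2 := Wc_nonneg (K * m)
  have h3 := Mc_nonneg (K * m)
  have h4 := WH_le y
  have h5 : (numOnes K m x : ℝ) + 1 ≤ numOnes K m y := by exact_mod_cast h
  have h6 : 0 ≤ ((numOnes K m y : ℝ) - (numOnes K m x + 1)) * Mc (K * m) :=
    mul_nonneg (by linarith) h3
  have h7 := mul_nonneg h2 (harm_nonneg (gap x))
  unfold phiF
  linarith

section
variable {K m : ℕ} {a d c B α : ℝ}

theorem phi_nonneg (x : Sol K m) : 0 ≤ phi a d c B α x := by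
  unfold phi
  split_ifs
  · exact phiF_nonneg x
  · have := Mc_nonneg (K * m)
    have := gsum_nonneg a d c B (K * m) (betaPrime K m a d c B x)
    positivity

theorem expW_lt (hα : α < 1) (x : Sol K m) (h : betaPrime K m a d c B x ≤ α) :
    a * (numOnes K m x : ℝ) < B := ((feas_iff a d c B α hα x).2 h).1

theorem phi_mono (hd : 0 < d) (hc : 0 < c) (hα : α < 1) (x z : Sol K m)
    (h : fge K m a d c B α (fun _ _ => 1) z x) : phi a d c B α z ≤ phi a d c B α x := by
  unfold fge at h
  rw [pPrime_eq, pPrime_eq] at h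
  unfold phi
  by_cases hx : betaPrime K m a d c B x ≤ α <;> by_cases hz : betaPrime K m a d c B z ≤ α
  · simp only [hx, hz, if_true] at h ⊢
    rcases h with h | ⟨h1, h2⟩
    · have h' : numOnes K m x < numOnes K m z := by exact_mod_cast h
      have := phiF_lt x z h'
      have := Wc_nonneg (K * m)
      linarith
    · have h1' : numOnes K m z = numOnes K m x := by exact_mod_cast h1
      have hq : sqs z ≤ sqs x := by
        by_contra hcon
        push Not at hcon
        have := beta_same_lt (a := a) (B := B) hd hc z x h1'.symm (expW_lt hα z hz) hcon
        linarith
      have hg : gap z ≤ gap x := by unfold gap; rw [h1']; omega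
      have := Wc_nonneg (K * m)
      have := harm_mono hg
      unfold phiF
      rw [h1']
      gcongr
  · simp only [hx, hz, if_true, if_false] at h
    have : (0:ℝ) ≤ numOnes K m x := by positivity
    rcases h with h | ⟨h, _⟩ <;> linarith
  · simp only [hx, hz, if_true, if_false]
    have := phiF_le z
    have := gsum_nonneg a d c B (K * m) (betaPrime K m a d c B x)
    linarith
  · simp only [hx, hz, if_false] at *
    rcases h with h | ⟨_, h2⟩
    · linarith
    · have := gsum_mono a d c B (K * m) h2
      linarith

theorem card_ones (x : Sol K m) :
    (Finset.univ.filter (fun s : Fin K × Fin m => x s.1 s.2 = true)).card = numOnes K m x := by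
  rw [Finset.card_filter, Fintype.sum_prod_type]
  rfl

theorem drift_infeas (hn : 2 ≤ K * m) (ha : 0 < a) (hB : 0 < B) (hd : 0 < d) (hc : 0 < c)
    (hα0 : 0 < α) (hα : α < 1) (x : Sol K m) (hx : ¬ betaPrime K m a d c B x ≤ α) :
    1 + ∑ y, stepP K m (mutEA K m) (fge K m a d c B α (fun _ _ => 1)) x y *
      ENNReal.ofReal (phi a d c B α y) ≤ ENNReal.ofReal (phi a d c B α x) := by
  have hl : 1 ≤ numOnes K m x := by
    by_contra hcon
    have h0 : numOnes K m x = 0 := by omega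
    have h1 := sqs_le x
    have h2 : sqs x = 0 := by rw [h0] at h1; omega
    apply hx
    rw [betaPrime_eq, h0, h2]
    simp [bfun, hB, hα0.le]
  have hn' : (2:ℝ) ≤ K * m := by exact_mod_cast hn
  have hl' : (1:ℝ) ≤ numOnes K m x := by exact_mod_cast hl
  refine step_drift K m hn _ _ phi_nonneg x (fun z hz => phi_mono hd hc hα x z hz)
    (Finset.univ.filter (fun s : Fin K × Fin m => x s.1 s.2 = true)) (flipb x)
    (flip_inj x).injOn ?_ (1 / (3 * (K * m : ℝ))) (by positivity)
    (fun _ => 3 * (K * m : ℝ) / numOnes K m x) ?_ (fun _ _ => by positivity)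
    (fun s _ => mutR_one K m hn x _ (hdist_flip x s)) ?_
  · intro s hs
    have hs' : x s.1 s.2 = true := by simpa using hs
    have hb := beta_down (B := B) ha hd hc x s hs'
    unfold fge
    rw [pPrime_eq, pPrime_eq, if_neg hx]
    split_ifs
    · left
      have : (0:ℝ) ≤ numOnes K m (flipb x s) := by positivity
      linarith
    · right; exact ⟨rfl, hb.le⟩
  · intro s hs
    have hs' : x s.1 s.2 = true := by simpa using hs
    have hb := beta_down (B := B) ha hd hc x s hs'
    have hdrop := gsum_drop a d c B (K * m) (numOnes K m x) (sqs x) hl (numOnes_le x) (sqs_le x)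
      (b' := betaPrime K m a d c B (flipb x s)) (by rw [← betaPrime_eq]; exact hb)
    rw [← betaPrime_eq] at hdrop
    push_cast at hdrop
    have h0 := gsum_nonneg a d c B (K * m) (betaPrime K m a d c B (flipb x s))
    unfold phi
    rw [if_neg hx]
    have := phiF_le (flipb x s)
    split_ifs <;> linarith
  · rw [Finset.sum_const, card_ones, nsmul_eq_mul]
    have hl0 : (numOnes K m x : ℝ) ≠ 0 := by positivity
    have hn0 : (K * m : ℝ) ≠ 0 := by positivity
    apply le_of_eq
    generalize (K * m : ℝ) = n at *
    field_simp

theorem drift_feas (hn : 2 ≤ K * m) (ha : 0 < a) (hd : 0 < d) (hc : 0 < c)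
    (hα : α < 1) (x : Sol K m) (hx : betaPrime K m a d c B x ≤ α)
    (hno : ∃ z : Sol K m, betaPrime K m a d c B z ≤ α ∧ numOnes K m x < numOnes K m z) :
    1 + ∑ y, stepP K m (mutEA K m) (fge K m a d c B α (fun _ _ => 1)) x y *
      ENNReal.ofReal (phi a d c B α y) ≤ ENNReal.ofReal (phi a d c B α x) := by
  have hn' : (2:ℝ) ≤ K * m := by exact_mod_cast hn
  rcases Nat.eq_zero_or_pos (gap x) with hg | hg
  · obtain ⟨z, hz, hzl⟩ := hno
    obtain ⟨z', hl', hz'⟩ := descend (B := B) (α := α) ha hd hc (numOnes K m x + 1)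
      (numOnes K m z - (numOnes K m x + 1)) z (by omega) hz
    obtain ⟨s, hs, hq⟩ := extend x z' hg hl'
    have hup := ones_up x s hs
    have hy : betaPrime K m a d c B (flipb x s) ≤ α :=
      (beta_same_le hd hc z' (flipb x s) (by omega) (expW_lt hα z' hz') hq).trans hz'
    refine step_drift K m hn _ _ phi_nonneg x (fun z hz => phi_mono hd hc hα x z hz)
      ({s} : Finset (Fin K × Fin m)) (flipb x)
      (flip_inj x).injOn ?_ (1 / (3 * (K * m : ℝ))) (by positivity)
      (fun _ => Wc (K * m)) ?_ (fun _ _ => Wc_nonneg _)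
      (fun s _ => mutR_one K m hn x _ (hdist_flip x s)) ?_
    · intro s' hs'
      rw [Finset.mem_singleton] at hs'
      subst hs'
      left
      rw [pPrime_eq, pPrime_eq, if_pos hx, if_pos hy, hup]
      push_cast; linarith
    · intro s' hs'
      rw [Finset.mem_singleton] at hs'
      subst hs'
      unfold phi
      rw [if_pos hx, if_pos hy]
      exact phiF_lt _ _ (by omega)
    · rw [Finset.sum_singleton]
      unfold Wc
      push_cast
      rw [div_mul_eq_mul_div, le_div_iff₀ (by positivity)]
      nlinarith
  · set g : Fin K → Fin K → ℕ := fun i j => 2 * (grp x i - grp x j - 1) with hgdef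
    set S := Finset.univ.filter (fun p : (Fin K × Fin m) × (Fin K × Fin m) =>
        x p.1.1 p.1.2 = true ∧ x p.2.1 p.2.2 = false ∧ 0 < g p.1.1 p.2.1) with hS
    have hSm : ∀ p ∈ S, x p.1.1 p.1.2 = true ∧ x p.2.1 p.2.2 = false ∧ 0 < g p.1.1 p.2.1 := by
      intro p hp
      simpa [hS] using hp
    have hswap : ∀ p ∈ S, numOnes K m (flipb (flipb x p.1) p.2) = numOnes K m x ∧
        sqs (flipb (flipb x p.1) p.2) + g p.1.1 p.2.1 = sqs x := by
      intro p hp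
      obtain ⟨h1, h2, h3⟩ := hSm p hp
      exact sqs_swap x p.1 p.2 h1 h2 h3
    have hfe : ∀ p ∈ S, betaPrime K m a d c B (flipb (flipb x p.1) p.2)
        ≤ betaPrime K m a d c B x := by
      intro p hp
      obtain ⟨h1, h2⟩ := hswap p hp
      exact beta_same_le hd hc x _ h1 (expW_lt hα x hx) (by omega)
    have hg' : (0:ℝ) < gap x := by exact_mod_cast hg
    have hgap : gap x ≤ ∑ p ∈ S, g p.1.1 p.2.1 := by
      rw [hS, swap_sum x g]
      obtain ⟨z, hz1, hz2⟩ := qmin_ex x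
      have := comb (m := m) (grp x) (grp z) (grp_le z) (by
        rw [← numOnes_eq, ← numOnes_eq, hz1]) (by
        have := qmin_le x
        rw [← hz2] at this
        exact this)
      unfold gap
      rw [← hz2]
      exact this
    refine step_drift K m hn _ _ phi_nonneg x (fun z hz => phi_mono hd hc hα x z hz)
      S (fun p => flipb (flipb x p.1) p.2)
      ((swap_inj x).mono fun p hp => ?_) ?_ (1 / (3 * (K * m : ℝ) ^ 2)) (by positivity)
      (fun p => Wc (K * m) * ((g p.1.1 p.2.1 : ℝ) / gap x)) ?_
      (fun _ _ => mul_nonneg (Wc_nonneg _) (by positivity))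
      ?_ ?_
    · obtain ⟨h1, h2, _⟩ := hSm p hp
      exact ⟨h1, h2⟩
    · intro p hp
      right
      rw [pPrime_eq, pPrime_eq, if_pos hx, if_pos ((hfe p hp).trans hx), (hswap p hp).1]
      exact ⟨rfl, hfe p hp⟩
    · intro p hp
      obtain ⟨h1, h2⟩ := hswap p hp
      unfold phi
      rw [if_pos hx, if_pos ((hfe p hp).trans hx)]
      unfold phiF
      have hle := qmin_le (flipb (flipb x p.1) p.2)
      have hgg : gap (flipb (flipb x p.1) p.2) + g p.1.1 p.2.1 = gap x := by
        unfold gap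
        rw [h1] at *
        omega
      have hh := harm_drop (gap x) hg (gap (flipb (flipb x p.1) p.2)) (g p.1.1 p.2.1) hgg.le
      rw [hgg] at hh
      have := mul_le_mul_of_nonneg_left hh (Wc_nonneg (K * m))
      rw [h1]
      linarith
    · intro p hp
      obtain ⟨h1, h2, _⟩ := hSm p hp
      refine mutR_two K m hn x _ (hdist_swap x _ _ ?_)
      intro h
      rw [h, h2] at h1
      exact absurd h1 (by simp)
    · rw [← Finset.mul_sum, ← Finset.sum_div]
      have hgap' : (gap x : ℝ) ≤ ∑ p ∈ S, (g p.1.1 p.2.1 : ℝ) := by exact_mod_cast hgap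
      have h1 : 1 ≤ (∑ p ∈ S, (g p.1.1 p.2.1 : ℝ)) / gap x := by
        rwa [le_div_iff₀ hg', one_mul]
      unfold Wc
      push_cast
      rw [← mul_assoc, one_div, inv_mul_cancel₀ (by positivity), one_mul]
      exact h1

theorem phi_bound (hn : 2 ≤ K * m) (x : Sol K m) :
    phi a d c B α x ≤ 18 * (K * m : ℝ) ^ 3 * (1 + Real.log (K * m : ℝ)) := by
  have hn' : (2:ℝ) ≤ K * m := by exact_mod_cast hn
  have h1 : phi a d c B α x ≤ ((K * m : ℕ) + 1) * Mc (K * m) + 6 * ((K * m : ℕ) : ℝ) ^ 3 := by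
    unfold phi
    split_ifs
    · have := phiF_le x
      have : (0:ℝ) ≤ 6 * ((K * m : ℕ) : ℝ) ^ 3 := by positivity
      linarith
    · have := gsum_le a d c B (K * m) (betaPrime K m a d c B x)
      linarith
  refine h1.trans ?_
  have h2 := harmonic_le_one_add_log ((K * m) ^ 2)
  unfold Mc Wc
  push_cast at *
  rw [Real.log_pow] at h2
  push_cast at h2
  set n : ℝ := K * m
  have hlog : 0 ≤ Real.log n := Real.log_nonneg (by linarith)
  have hM : 3 * n ^ 2 * ((harmonic ((K * m) ^ 2) : ℚ) : ℝ) + 3 * n ^ 2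
      ≤ 3 * n ^ 2 * (1 + 2 * Real.log n) + 3 * n ^ 2 := by gcongr
  have hM0 : 0 ≤ 3 * n ^ 2 * (1 + 2 * Real.log n) + 3 * n ^ 2 := by positivity
  calc _ ≤ (2 * n) * (3 * n ^ 2 * (1 + 2 * Real.log n) + 3 * n ^ 2) + 6 * n ^ 3 := by
        refine add_le_add_left (mul_le_mul (by linarith) hM ?_ (by linarith)) _
        have := harm_nonneg ((K * m) ^ 2)
        positivity
    _ ≤ _ := by
        have : 0 ≤ n ^ 3 * Real.log n := by positivity
        nlinarith
end

/-- (1+1) EA on the uniform-profit instance, `n = K·m ≥ 2`: there is a constant `C > 0`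
depending only on `c` and `d` such that, from every initial solution, the expected number
of iterations until the current solution is, for the first time, a feasible solution of
maximal profit among all feasible solutions is at most `C·n³·(1 + log n)`. -/
theorem EA_uniform_profit_optimization (c d : ℝ) (hc : 0 < c) (hd : 0 < d) :
    ∃ C : ℝ, 0 < C ∧
      ∀ (K m : ℕ), 1 ≤ K → 1 ≤ m → 2 ≤ K * m →
      ∀ (a B α : ℝ), 0 < a → 0 < B → 0 < α → α < 1 →
      ∀ x₀ : Fin K → Fin m → Bool,
        expHitTime K m
            (stepP K m (mutEA K m) (fge K m a d c B α (fun _ _ => 1)))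
            (fun y => feasible K m a d c B α y ∧
              ∀ z, feasible K m a d c B α z → numOnes K m z ≤ numOnes K m y) x₀ ≤
          ENNReal.ofReal (C * (K * m : ℝ) ^ 3 * (1 + Real.log (K * m : ℝ))) := by
  refine ⟨18, by norm_num, ?_⟩
  intro K m _ _ hn a B α ha hB hα0 hα x₀
  refine le_trans (expHit_le K m _ _ (fun y => ENNReal.ofReal (phi a d c B α y)) ?_ x₀)
    (ENNReal.ofReal_le_ofReal (phi_bound hn x₀))
  intro x hx
  by_cases hfx : betaPrime K m a d c B x ≤ α
  · refine drift_feas hn ha hd hc hα x hfx ?_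
    by_contra hcon
    apply hx
    push Not at hcon
    exact ⟨(feas_iff a d c B α hα x).2 hfx, fun z hz => hcon z ((feas_iff a d c B α hα z).1 hz)⟩
  · exact drift_infeas hn ha hB hd hc hα0 hα x hfx
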